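/- arXiv:1611.07622 — 6 statements merged into one kernel-verified Lean document; each statement's English description precedes it below -/
import Mathlib

section
/- An initial state s^e ∈ θ^e is an initial deadlock for the system if and only if the vertex v_{s^e} ∈ V^R₀ has exactly one outgoing edge, of weight −1, leading to v^loss₁ ∈ V^R₁ in C^loss, and no initial credit c ∈ ℕ suffices for player-0 to win from v_∅ ∈ V^R₁. -/
universe u v

/-- A symbolic weighted game graph `G^sym = ⟨θᵉ, θˢ, ρᵉ, ρˢ, w⟩` for reactive energy games.
`Se` is the type `𝒱_env` of assignments to the environment variables and `Ss` is the type
`𝒱_sys` of assignments to the system variables; a state is a pair in `Se × Ss`.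
`rhoE s se` says that the environment choice `se` is a valid environment transition from `s`
(`t_{s,se} ∈ ρᵉ`), and `rhoS s se ss` says the system choice `ss` completes it to a valid
system transition (`t_{s,se,ss} ∈ ρˢ`). The weight `w` is only relevant on valid transitions. -/
structure SymGG (Se : Type u) (Ss : Type v) where
  thetaE : Se → Prop
  thetaS : Se → Ss → Prop
  rhoE : Se × Ss → Se → Prop
  rhoS : Se × Ss → Se → Ss → Prop
  w : Se × Ss → Se × Ss → ℤ

variable {Se : Type u} {Ss : Type v}

/-- A state `s` is a deadlock for the environment: no valid environment choice from `s`. -/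
def SymGG.envDeadlock (G : SymGG Se Ss) (s : Se × Ss) : Prop := ¬ ∃ se, G.rhoE s se

/-- A valid environment transition `t_{s,se}` is a deadlock for the system: no valid
system completion. -/
def SymGG.sysDeadlock (G : SymGG Se Ss) (s : Se × Ss) (se : Se) : Prop := ¬ ∃ ss, G.rhoS s se ss

/-- An initial state `se ∈ θᵉ` is an initial deadlock for the system: no system choice `ss`
with `se ∪ ss ∈ θˢ`. -/
def SymGG.initSysDeadlock (G : SymGG Se Ss) (se : Se) : Prop := ¬ ∃ ss, G.thetaS se ss

/-- Vertices of the reduced bipartite energy game graph `Γ^R`: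
`init` is `v_∅`; `winP0,winP1` are `v₀^win, v₁^win` of the cycle `C^win`;
`lossP0,lossP1` are `v₀^loss, v₁^loss` of the cycle `C^loss`;
`initEnv se` is `v_{sᵉ}`; `state s` is `v_s`; `trans s se` is `v_{t_{s,sᵉ}}`. -/
inductive RV (Se : Type u) (Ss : Type v) : Type (max u v) where
  | init : RV Se Ss
  | winP0 : RV Se Ss
  | winP1 : RV Se Ss
  | lossP0 : RV Se Ss
  | lossP1 : RV Se Ss
  | initEnv (se : Se) : RV Se Ss
  | state (s : Se × Ss) : RV Se Ss
  | trans (s : Se × Ss) (se : Se) : RV Se Ss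

/-- The player-0 (system / maximizer) vertices `V₀^R` of `Γ^R`; the remaining vertices
are the player-1 (environment / minimizer) vertices `V₁^R`. -/
def RV.isP0 : RV Se Ss → Prop
  | .winP0 => True
  | .lossP0 => True
  | .initEnv _ => True
  | .trans _ _ => True
  | _ => False

/-- The edge relation `E^R` of the reduced energy game graph `Γ^R` obtained from `G^sym`. -/
inductive REdge (G : SymGG Se Ss) : RV Se Ss → RV Se Ss → Prop where
  | winCyc1 : REdge G .winP0 .winP1
  | winCyc2 : REdge G .winP1 .winP0
  | lossCyc1 : REdge G .lossP0 .lossP1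
  | lossCyc2 : REdge G .lossP1 .lossP0
  | emptyWin : (¬ ∃ se, G.thetaE se) → REdge G .init .winP0
  | toInitEnv {se : Se} : G.thetaE se → REdge G .init (.initEnv se)
  | initToState {se : Se} {ss : Ss} : G.thetaE se → G.thetaS se ss →
      REdge G (.initEnv se) (.state (se, ss))
  | initSysDead {se : Se} : G.thetaE se → (¬ ∃ ss, G.thetaS se ss) →
      REdge G (.initEnv se) .lossP1
  | envMove {s : Se × Ss} {se : Se} : G.rhoE s se → REdge G (.state s) (.trans s se)
  | sysDead {s : Se × Ss} {se : Se} : G.rhoE s se → (¬ ∃ ss, G.rhoS s se ss) →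
      REdge G (.trans s se) .lossP1
  | sysMove {s : Se × Ss} {se : Se} {ss : Ss} : G.rhoE s se → G.rhoS s se ss →
      REdge G (.trans s se) (.state (se, ss))
  | envDeadWin {s : Se × Ss} : (¬ ∃ se, G.rhoE s se) → REdge G (.state s) .winP0

/-- The weight function `w^R` of `Γ^R` (on non-edges its value is irrelevant). -/
def wR (G : SymGG Se Ss) : RV Se Ss → RV Se Ss → ℤ
  | .winP0, .winP1 => 1
  | .lossP0, .lossP1 => -1
  | .initEnv _, .lossP1 => -1
  | .trans _ _, .lossP1 => -1
  | .trans s _, .state s2 => G.w s s2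
  | _, _ => 0

/-- An (infinite) EG play on `Γ^R`. -/
def IsRPlay (G : SymGG Se Ss) (p : ℕ → RV Se Ss) : Prop :=
  ∀ i, REdge G (p i) (p (i + 1))

/-- The energy level `EL(p, j) = c + Σ_{i<j} w^R(p i, p (i+1))` of a play on `Γ^R`
for initial credit `c`. -/
def REL (G : SymGG Se Ss) (c : ℕ) (p : ℕ → RV Se Ss) (j : ℕ) : ℤ :=
  (c : ℤ) + ∑ i ∈ Finset.range j, wR G (p i) (p (i + 1))

/-- Initial credit `c` suffices for player-0 to win the energy game on `Γ^R` from vertex `v`: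
player-0 has a strategy (choosing valid edges at player-0 vertices, given the history)
such that every play from `v` consistent with it keeps the energy level non-negative. -/
def WinsFrom (G : SymGG Se Ss) (c : ℕ) (v : RV Se Ss) : Prop :=
  ∃ σ : List (RV Se Ss) → RV Se Ss → RV Se Ss,
    (∀ h u, RV.isP0 u → (∃ u', REdge G u u') → REdge G u (σ h u)) ∧
    ∀ p : ℕ → RV Se Ss, p 0 = v → IsRPlay G p →
      (∀ i, RV.isP0 (p i) → p (i + 1) = σ (List.ofFn fun k : Fin i => p k.1) (p i)) →
      ∀ k, 1 ≤ k → 0 ≤ REL G c p k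

/-- An infinite reactive EG play `p^sym = s₀s₁…` on `G^sym`: it starts at an initial state
in `θᵉ ∩ θˢ` and each step is a valid transition (environment choice completed by the system). -/
def IsReactivePlay (G : SymGG Se Ss) (q : ℕ → Se × Ss) : Prop :=
  (G.thetaE (q 0).1 ∧ G.thetaS (q 0).1 (q 0).2) ∧
  ∀ i, G.rhoE (q i) (q (i + 1)).1 ∧ G.rhoS (q i) (q (i + 1)).1 (q (i + 1)).2

/-- The energy level `EL(p^sym, j) = c + Σ_{i<j} w(s_i, s_{i+1})` of a reactive play on `G^sym`. -/
def ELsym (G : SymGG Se Ss) (c : ℕ) (q : ℕ → Se × Ss) (j : ℕ) : ℤ :=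
  (c : ℤ) + ∑ i ∈ Finset.range j, G.w (q i) (q (i + 1))

/-- The play on `Γ^R` corresponding to a reactive play `q` on `G^sym`:
`v_∅ v_{sᵉ₀} v_{s₀} v_{t_{s₀,sᵉ₁}} v_{s₁} v_{t_{s₁,sᵉ₂}} v_{s₂} …`. -/
def corr (q : ℕ → Se × Ss) : ℕ → RV Se Ss := fun n =>
  if n = 0 then .init
  else if n = 1 then .initEnv (q 0).1
  else if n % 2 = 0 then .state (q (n / 2 - 1))
  else .trans (q (n / 2 - 1)) (q (n / 2)).1

/-- The play `v_∅ v_{sᵉ} v₁^loss v₀^loss v₁^loss …` that falls into `C^loss` right after `se`. -/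
def lossPlay (se : Se) : ℕ → RV Se Ss
  | 0 => .init
  | 1 => .initEnv se
  | 2 => .lossP1
  | 3 => .lossP0
  | n + 4 => lossPlay se (n + 2)

theorem lossPlay_even (se : Se) (m : ℕ) :
    lossPlay (Ss := Ss) se (2 * m + 2) = .lossP1 := by
  induction m with
  | zero => rfl
  | succ m ih => exact ih

theorem lossPlay_odd (se : Se) (m : ℕ) :
    lossPlay (Ss := Ss) se (2 * m + 3) = .lossP0 := by
  induction m with
  | zero => rfl
  | succ m ih => exact ih

/-- Case analysis on a consecutive pair of vertices of `lossPlay`. -/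
theorem lossPlay_step {P : RV Se Ss → RV Se Ss → Prop} (se : Se)
    (h₀ : P .init (.initEnv se)) (h₁ : P (.initEnv se) .lossP1)
    (h₂ : P .lossP1 .lossP0) (h₃ : P .lossP0 .lossP1) :
    ∀ n, P (lossPlay se n) (lossPlay se (n + 1))
  | 0 => h₀
  | 1 => h₁
  | 2 => h₂
  | 3 => h₃
  | n + 4 => lossPlay_step se h₀ h₁ h₂ h₃ (n + 2)

theorem REL_lossPlay (G : SymGG Se Ss) (c : ℕ) (se : Se) (m : ℕ) :
    REL G c (lossPlay se) (2 * m) = c - m := by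
  induction m with
  | zero => simp [REL]
  | succ m ih =>
    have hw : wR G (lossPlay se (2 * m)) (lossPlay se (2 * m + 1)) = 0 ∧
        wR G (lossPlay se (2 * m + 1)) (lossPlay se (2 * m + 2)) = -1 := by
      cases m with
      | zero => exact ⟨rfl, rfl⟩
      | succ m =>
        rw [lossPlay_even se (m + 1),
          show 2 * (m + 1) + 1 = 2 * m + 3 by ring, lossPlay_odd,
          show 2 * (m + 1) = 2 * m + 2 by ring, lossPlay_even]
        exact ⟨rfl, rfl⟩
    unfold REL at ih ⊢
    rw [show 2 * (m + 1) = 2 * m + 1 + 1 by ring, Finset.sum_range_succ, Finset.sum_range_succ,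
      hw.1, hw.2]
    push_cast
    linarith

theorem REdge_initEnv_iff_of_initSysDeadlock {G : SymGG Se Ss} {se : Se} (hse : G.thetaE se)
    (hd : G.initSysDeadlock se) (u : RV Se Ss) :
    REdge G (.initEnv se) u ↔ u = .lossP1 := by
  constructor
  · intro h
    cases h with
    | initToState _ hs => exact absurd ⟨_, hs⟩ hd
    | initSysDead => rfl
  · rintro rfl
    exact .initSysDead hse hd

theorem not_winsFrom_init_of_initSysDeadlock {G : SymGG Se Ss} {se : Se} (hse : G.thetaE se)
    (hd : G.initSysDeadlock se) (c : ℕ) : ¬ WinsFrom G c RV.init := by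
  rintro ⟨σ, hσ, hwin⟩
  have hplay : IsRPlay G (lossPlay se) :=
    lossPlay_step se (.toInitEnv hse) (.initSysDead hse hd) .lossCyc2 .lossCyc1
  have huniq : ∀ i, RV.isP0 (lossPlay (Ss := Ss) se i) →
      ∀ u, REdge G (lossPlay se i) u → u = lossPlay se (i + 1) :=
    lossPlay_step (P := fun a b => a.isP0 → ∀ u, REdge G a u → u = b) se
      (fun h => h.elim)
      (fun _ u => (REdge_initEnv_iff_of_initSysDeadlock hse hd u).1)
      (fun h => h.elim)
      (fun _ u h => by cases h; rfl)
  have hk := hwin (lossPlay se) rfl hplay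
    (fun i hi => (huniq i hi _ (hσ _ _ hi ⟨_, hplay i⟩)).symm) (2 * (c + 1)) (by omega)
  rw [REL_lossPlay] at hk
  push_cast at hk
  linarith

/-- Lemma 2: `sᵉ ∈ θᵉ` is an initial deadlock state for the system iff
`v_{sᵉ} ∈ V₀^R` has exactly one outgoing edge, of weight `-1`, to `v₁^loss ∈ V₁^R` in
`C^loss`, and no initial credit `c ∈ ℕ` suffices for player-0 to win from `v_∅ ∈ V₁^R`. -/
theorem stmt1 (G : SymGG Se Ss) (se : Se) (hse : G.thetaE se) :
    G.initSysDeadlock se ↔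
      ((∀ u, REdge G (RV.initEnv se) u ↔ u = RV.lossP1) ∧
        wR G (RV.initEnv se) RV.lossP1 = -1 ∧
        ¬ ∃ c : ℕ, WinsFrom G c RV.init) := by
  constructor
  · intro hd
    exact ⟨REdge_initEnv_iff_of_initSysDeadlock hse hd, rfl,
      fun ⟨c, hc⟩ => not_winsFrom_init_of_initSysDeadlock hse hd c hc⟩
  · rintro ⟨hu, -, -⟩ ⟨ss, hs⟩
    cases (hu _).1 (.initToState hse hs)
end

section
/- A state s ∈ θ^e ∩ θ^s that is an initial state is a deadlock for the environment in G^sym if and only if the vertex v_s ∈ V^R₁ has exactly one outgoing edge, of weight 0, leading to v^win₀ ∈ V^R₀ in C^win, and every initial credit c ∈ ℕ suffices for player-0 to win from v_s. -/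
universe u v

variable {Se : Type u} {Ss : Type v}

/-- If every play from `v` only traverses edges of non-negative weight, as witnessed by a set `S`
of vertices closed under edges, then every initial credit suffices to win from `v`. -/
theorem WinsFrom.of_closed_nonneg (G : SymGG Se Ss) (S : Set (RV Se Ss)) {v : RV Se Ss}
    (hv : v ∈ S) (hS : ∀ a ∈ S, ∀ b, REdge G a b → b ∈ S ∧ 0 ≤ wR G a b) (c : ℕ) :
    WinsFrom G c v := by
  classical
  refine ⟨fun _ u => if h : ∃ u', REdge G u u' then h.choose else u, ?_, ?_⟩
  · intro _ u _ h
    simpa only [dif_pos h] using h.choose_spec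
  · intro p h0 hp _ k _
    have hmem : ∀ i, p i ∈ S := by
      intro i
      induction i with
      | zero => exact h0 ▸ hv
      | succ i ih => exact (hS _ ih _ (hp i)).1
    exact add_nonneg (Int.natCast_nonneg c)
      (Finset.sum_nonneg fun i _ => (hS _ (hmem i) _ (hp i)).2)

/-- The only outgoing edge of an environment deadlock leads to the winning cycle. -/
theorem SymGG.envDeadlock.edge_iff {G : SymGG Se Ss} {s : Se × Ss} (hd : G.envDeadlock s)
    (u : RV Se Ss) : REdge G (.state s) u ↔ u = .winP0 := by
  constructor
  · rintro (_ | _)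
    · exact absurd ⟨_, ‹_›⟩ hd
    · rfl
  · rintro rfl
    exact .envDeadWin hd

/-- Every initial credit suffices to win from an environment deadlock. -/
theorem SymGG.envDeadlock.winsFrom {G : SymGG Se Ss} {s : Se × Ss} (hd : G.envDeadlock s)
    (c : ℕ) : WinsFrom G c (.state s) := by
  refine WinsFrom.of_closed_nonneg G {.state s, .winP0, .winP1} (by simp) ?_ c
  rintro a (rfl | rfl | rfl) b hab
  · obtain rfl := (hd.edge_iff b).1 hab
    simp [wR]
  · cases hab
    simp [wR]
  · cases hab
    simp [wR]

/-- Lemma 3: an initial state `s = (sᵉ, sˢ) ∈ θᵉ ∩ θˢ` is a deadlock for the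
environment in `G^sym` iff `v_s ∈ V₁^R` has exactly one outgoing edge, of weight `0`, to
`v₀^win ∈ V₀^R` in `C^win`, and every initial credit `c ∈ ℕ` suffices for player-0 to win
from `v_s`. -/
theorem stmt2 (G : SymGG Se Ss) (se : Se) (ss : Ss)
    (h1 : G.thetaE se) (h2 : G.thetaS se ss) :
    G.envDeadlock (se, ss) ↔
      ((∀ u, REdge G (RV.state (se, ss)) u ↔ u = RV.winP0) ∧
        wR G (RV.state (se, ss)) RV.winP0 = 0 ∧
        ∀ c : ℕ, WinsFrom G c (RV.state (se, ss))) := by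
  refine ⟨fun hd => ⟨hd.edge_iff, rfl, hd.winsFrom⟩, ?_⟩
  rintro ⟨hedge, -, -⟩ ⟨se', h⟩
  cases (hedge _).1 (.envMove h)
end

section
/- A state s₂ that has a predecessor state s₁ with t_{s₁,s₂} ∈ ρ^e ∩ ρ^s is a deadlock for the environment in G^sym if and only if the vertex v_{s₂} ∈ V^R₁ has exactly one outgoing edge, of weight 0, leading to v^win₀ ∈ V^R₀ in C^win, and every initial credit c ∈ ℕ suffices for player-0 to win from v_{s₂}. -/
universe u v

variable {Se : Type u} {Ss : Type v}

/-- The vertices of `C^win`, together with the vertices of environment deadlocks. -/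
def SymGG.WinRegion (G : SymGG Se Ss) : RV Se Ss → Prop
  | .winP0 => True
  | .winP1 => True
  | .state s => G.envDeadlock s
  | _ => False

theorem SymGG.WinRegion.step {G : SymGG Se Ss} {u u' : RV Se Ss} (hu : G.WinRegion u)
    (h : REdge G u u') : G.WinRegion u' ∧ 0 ≤ wR G u u' := by
  cases h with
  | winCyc1 => exact ⟨trivial, by simp [wR]⟩
  | winCyc2 => exact ⟨trivial, le_rfl⟩
  | envMove h => exact (hu ⟨_, h⟩).elim
  | envDeadWin _ => exact ⟨trivial, le_rfl⟩
  | _ => exact hu.elim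

theorem SymGG.WinRegion.REL_nonneg {G : SymGG Se Ss} {p : ℕ → RV Se Ss}
    (h0 : G.WinRegion (p 0)) (hp : IsRPlay G p) (c k : ℕ) : 0 ≤ REL G c p k := by
  have hw : ∀ i, G.WinRegion (p i) := fun i => by
    induction i with
    | zero => exact h0
    | succ i ih => exact (ih.step (hp i)).1
  exact add_nonneg (Int.natCast_nonneg c)
    (Finset.sum_nonneg fun i _ => ((hw i).step (hp i)).2)

open Classical in
theorem SymGG.WinRegion.winsFrom {G : SymGG Se Ss} {v : RV Se Ss} (hv : G.WinRegion v) (c : ℕ) :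
    WinsFrom G c v := by
  refine ⟨fun _ u => if h : ∃ u', REdge G u u' then h.choose else u, ?_, ?_⟩
  · intro _ u _ h
    simpa only [dif_pos h] using h.choose_spec
  · intro p hp0 hp _ k _
    exact REL_nonneg (hp0 ▸ hv) hp c k

theorem REdge.state_iff_of_envDeadlock {G : SymGG Se Ss} {s : Se × Ss} (hs : G.envDeadlock s)
    (u : RV Se Ss) : REdge G (.state s) u ↔ u = .winP0 := by
  constructor
  · intro h
    cases h with
    | envMove h => exact (hs ⟨_, h⟩).elim
    | envDeadWin _ => rfl
  · rintro rfl
    exact .envDeadWin hs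

theorem REdge.envDeadlock_of_state_winP0 {G : SymGG Se Ss} {s : Se × Ss}
    (h : REdge G (.state s) .winP0) : G.envDeadlock s := by
  cases h with
  | envDeadWin h => exact h

/-- Lemma 5: a state `s₂` with a predecessor `s₁` such that
`t_{s₁,s₂} ∈ ρᵉ ∩ ρˢ` is a deadlock for the environment in `G^sym` iff `v_{s₂} ∈ V₁^R` has
exactly one outgoing edge, of weight `0`, to `v₀^win ∈ V₀^R` in `C^win`, and every initial
credit `c ∈ ℕ` suffices for player-0 to win from `v_{s₂}`. -/
theorem stmt4 (G : SymGG Se Ss) (s1 s2 : Se × Ss)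
    (h1 : G.rhoE s1 s2.1) (h2 : G.rhoS s1 s2.1 s2.2) :
    G.envDeadlock s2 ↔
      ((∀ u, REdge G (RV.state s2) u ↔ u = RV.winP0) ∧
        wR G (RV.state s2) RV.winP0 = 0 ∧
        ∀ c : ℕ, WinsFrom G c (RV.state s2)) := by
  exact ⟨fun hd => ⟨REdge.state_iff_of_envDeadlock hd, rfl,
      SymGG.WinRegion.winsFrom (v := .state s2) hd⟩,
    fun h => REdge.envDeadlock_of_state_winP0 ((h.1 _).2 rfl)⟩
end

section
/- Given an initial credit c ∈ ℕ, for all j ≥ 1 and e ∈ ℤ: there exists an infinite reactive EG play p^sym = s₀s₁…s_{j−1}s_j… on G^sym with EL(p^sym,j) = e if and only if there exists an EG play p = v_∅ v_{s^e₀} v_{s₀} v_{t_{s₀,s^e₁}} v_{s₁} … v_{s_{j−1}} v_{t_{s_{j−1},s^e_j}} v_{s_j} … on Γ^R with EL(p, 2+2j) = e. -/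
universe u v

variable {Se : Type u} {Ss : Type v}

theorem corr_state (q : ℕ → Se × Ss) (i : ℕ) : corr q (2 * i + 2) = .state (q i) := by
  simp [corr]

theorem corr_trans (q : ℕ → Se × Ss) (i : ℕ) :
    corr q (2 * i + 3) = .trans (q i) (q (i + 1)).1 := by
  have h : (2 * i + 3) / 2 = i + 1 := by omega
  simp [corr, h]

theorem isRPlay_corr_iff (G : SymGG Se Ss) (q : ℕ → Se × Ss) :
    IsRPlay G (corr q) ↔ IsReactivePlay G q := by
  constructor
  · intro h
    refine ⟨?_, fun i => ?_⟩
    · have h1 : REdge G (.initEnv (q 0).1) (.state (q 0)) := h 1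
      generalize q 0 = s at h1 ⊢
      obtain ⟨se, ss⟩ := s
      cases h1 with
      | initToState he hs => exact ⟨he, hs⟩
    · have h1 : REdge G (corr q (2 * i + 3)) (corr q (2 * (i + 1) + 2)) := h (2 * i + 3)
      rw [corr_trans, corr_state] at h1
      generalize q (i + 1) = s at h1 ⊢
      obtain ⟨se, ss⟩ := s
      cases h1 with
      | sysMove he hs => exact ⟨he, hs⟩
  · rintro ⟨⟨he, hs⟩, hstep⟩ n
    match n with
    | 0 => exact .toInitEnv he
    | 1 => exact .initToState he hs
    | n + 2 =>
      obtain ⟨i, rfl | rfl⟩ := Nat.even_or_odd' n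
      · rw [corr_state, corr_trans]
        exact .envMove (hstep i).1
      · change REdge G (corr q (2 * i + 3)) (corr q (2 * (i + 1) + 2))
        rw [corr_trans, corr_state]
        exact .sysMove (hstep i).1 (hstep i).2

theorem REL_corr (G : SymGG Se Ss) (c : ℕ) (q : ℕ → Se × Ss) (j : ℕ) :
    REL G c (corr q) (2 + 2 * j) = ELsym G c q j := by
  induction j with
  | zero => simp [REL, ELsym, Finset.sum_range_succ, corr, wR]
  | succ j ih =>
    have h₁ : wR G (corr q (2 * j + 2)) (corr q (2 * j + 3)) = 0 := by
      rw [corr_state, corr_trans]; rfl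
    have h₂ : wR G (corr q (2 * j + 3)) (corr q (2 * (j + 1) + 2)) = G.w (q j) (q (j + 1)) := by
      rw [corr_trans, corr_state]; rfl
    have hR : REL G c (corr q) (2 + 2 * (j + 1)) = REL G c (corr q) (2 + 2 * j) +
        wR G (corr q (2 * j + 2)) (corr q (2 * j + 3)) +
        wR G (corr q (2 * j + 3)) (corr q (2 * (j + 1) + 2)) := by
      rw [show 2 + 2 * (j + 1) = 2 * j + 2 + 1 + 1 by omega, add_comm 2 (2 * j)]
      rw [REL, Finset.sum_range_succ, Finset.sum_range_succ, ← add_assoc, ← add_assoc]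
      rfl
    rw [hR, ih, h₁, h₂, add_zero]
    simp only [ELsym, Finset.sum_range_succ, add_assoc]

/-- Theorem 1: given an initial credit `c`, for all `j ≥ 1` and `e ∈ ℤ`,
there is an infinite reactive EG play `p^sym` on `G^sym` with `EL(p^sym, j) = e` iff there is
an EG play `p = v_∅ v_{sᵉ₀} v_{s₀} v_{t_{s₀,sᵉ₁}} v_{s₁} …` on `Γ^R` with `EL(p, 2+2j) = e`. -/
theorem stmt7 (G : SymGG Se Ss) (c : ℕ) :
    ∀ j : ℕ, 1 ≤ j → ∀ e : ℤ,
      ((∃ q : ℕ → Se × Ss, IsReactivePlay G q ∧ ELsym G c q j = e) ↔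
        (∃ q : ℕ → Se × Ss, IsRPlay G (corr q) ∧ REL G c (corr q) (2 + 2 * j) = e)) := by
  intro j _ e
  simp only [isRPlay_corr_iff, REL_corr]
end

section
/- Given an initial credit c ∈ ℕ, for all e ∈ ℕ, n ∈ ℕ, and 1 ≤ j ≤ n: there exists a finite winning reactive EG play p^sym = s₀s₁…s_{n−1}s_n on G^sym that ends with a deadlock for the environment and has EL(p^sym,j) = e if and only if there exists an EG play p = v_∅ v_{s^e₀} v_{s₀} v_{t_{s₀,s^e₁}} v_{s₁} … v_{s_{n−1}} v_{t_{s_{n−1},s^e_n}} v_{s_n} (v^win₀ v^win₁)^ω on Γ^R with EL(p, 2+2j) = e and EL(p,k) ≥ 0 for all k ≥ 1. -/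
universe u v

variable {Se : Type u} {Ss : Type v}

/-- A finite reactive EG play `s₀ s₁ … s_n` on `G^sym` (represented by the first `n+1` values
of `q`): it starts at an initial state in `θᵉ ∩ θˢ` and takes valid transitions for `n` steps. -/
def IsFiniteReactivePlay (G : SymGG Se Ss) (q : ℕ → Se × Ss) (n : ℕ) : Prop :=
  (G.thetaE (q 0).1 ∧ G.thetaS (q 0).1 (q 0).2) ∧
  ∀ i, i < n → G.rhoE (q i) (q (i + 1)).1 ∧ G.rhoS (q i) (q (i + 1)).1 (q (i + 1)).2

/-- The play `v_∅ v_{sᵉ₀} v_{s₀} … v_{t_{s_{n-1},sᵉ_n}} v_{s_n} (v₀^win v₁^win)^ω` on `Γ^R`. -/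
def corrWin (q : ℕ → Se × Ss) (n : ℕ) : ℕ → RV Se Ss := fun k =>
  if k ≤ 2 * n + 2 then corr q k
  else if (k - (2 * n + 2)) % 2 = 1 then .winP0 else .winP1

section CorrWin

variable (q : ℕ → Se × Ss) (n : ℕ)

lemma corrWin_zero : corrWin q n 0 = .init := by
  simp [corrWin, corr]

lemma corrWin_one : corrWin q n 1 = .initEnv (q 0).1 := by
  simp [corrWin, corr]

lemma corrWin_state {i : ℕ} (hi : i ≤ n) : corrWin q n (2 * i + 2) = .state (q i) := by
  simp [corrWin, corr, hi]

lemma corrWin_trans {i : ℕ} (hi : i < n) :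
    corrWin q n (2 * i + 3) = .trans (q i) (q (i + 1)).1 := by
  have h1 : 2 * i + 3 ≤ 2 * n + 2 := by omega
  have h2 : (2 * i + 3) % 2 = 1 := by omega
  have h3 : (2 * i + 3) / 2 = i + 1 := by omega
  simp [corrWin, corr, h1, h2, h3]

lemma corrWin_winP0 (m : ℕ) : corrWin q n (2 * n + 3 + 2 * m) = .winP0 := by
  have h1 : ¬ 2 * n + 3 + 2 * m ≤ 2 * n + 2 := by omega
  have h2 : (2 * n + 3 + 2 * m - (2 * n + 2)) % 2 = 1 := by omega
  simp only [corrWin, h1, h2, if_true, if_false]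

lemma corrWin_winP1 (m : ℕ) : corrWin q n (2 * n + 4 + 2 * m) = .winP1 := by
  have h1 : ¬ 2 * n + 4 + 2 * m ≤ 2 * n + 2 := by omega
  have h2 : ¬ (2 * n + 4 + 2 * m - (2 * n + 2)) % 2 = 1 := by omega
  simp only [corrWin, h1, h2, if_false]

/-- The positions of `corrWin q n`: the initial vertex, the initial environment choice, the
states, the intermediate transitions, and the two phases of the winning cycle. -/
lemma corrWin_index_cases (k : ℕ) :
    k = 0 ∨ k = 1 ∨ (∃ i ≤ n, k = 2 * i + 2) ∨ (∃ i < n, k = 2 * i + 3) ∨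
      (∃ m, k = 2 * n + 3 + 2 * m) ∨ ∃ m, k = 2 * n + 4 + 2 * m := by
  by_cases hk : k ≤ 1
  · omega
  rcases Nat.even_or_odd' k with ⟨i, rfl | rfl⟩
  · by_cases hi : i ≤ n + 1
    · exact .inr (.inr (.inl ⟨i - 1, by omega, by omega⟩))
    · exact .inr (.inr (.inr (.inr (.inr ⟨i - n - 2, by omega⟩))))
  · by_cases hi : i ≤ n
    · exact .inr (.inr (.inr (.inl ⟨i - 1, by omega, by omega⟩)))
    · exact .inr (.inr (.inr (.inr (.inl ⟨i - n - 1, by omega⟩))))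

variable (G : SymGG Se Ss)

/-- The play `corrWin q n` is a play on the reduced graph exactly when `q` describes a finite
reactive play of `n` steps that ends with a deadlock for the environment. -/
lemma isRPlay_corrWin_iff :
    IsRPlay G (corrWin q n) ↔ IsFiniteReactivePlay G q n ∧ G.envDeadlock (q n) := by
  constructor
  · intro h
    refine ⟨⟨⟨?_, ?_⟩, fun i hi => ⟨?_, ?_⟩⟩, ?_⟩
    · have h0 := h 0
      rw [zero_add, corrWin_zero, corrWin_one] at h0
      cases h0
      assumption
    · have h0 := h 1
      rw [corrWin_one, show 1 + 1 = 2 * 0 + 2 from rfl, corrWin_state q n (Nat.zero_le n)] at h0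
      generalize hs : q 0 = s at h0 ⊢
      obtain ⟨a, b⟩ := s
      cases h0
      assumption
    · have h0 := h (2 * i + 2)
      rw [corrWin_state q n hi.le, corrWin_trans q n hi] at h0
      cases h0
      assumption
    · have h0 := h (2 * i + 3)
      rw [corrWin_trans q n hi, show 2 * i + 3 + 1 = 2 * (i + 1) + 2 by ring,
        corrWin_state q n hi] at h0
      generalize q (i + 1) = s at h0 ⊢
      obtain ⟨a, b⟩ := s
      cases h0
      assumption
    · have h0 := h (2 * n + 2)
      rw [corrWin_state q n le_rfl, show 2 * n + 2 + 1 = 2 * n + 3 + 2 * 0 by ring,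
        corrWin_winP0] at h0
      cases h0
      assumption
  · rintro ⟨⟨⟨hE, hS⟩, hstep⟩, hdead⟩ k
    rcases corrWin_index_cases n k with
      rfl | rfl | ⟨i, hi, rfl⟩ | ⟨i, hi, rfl⟩ | ⟨m, rfl⟩ | ⟨m, rfl⟩
    · rw [zero_add, corrWin_zero, corrWin_one]
      exact .toInitEnv hE
    · rw [corrWin_one, show 1 + 1 = 2 * 0 + 2 from rfl, corrWin_state q n (Nat.zero_le n)]
      exact .initToState hE hS
    · rw [corrWin_state q n hi]
      rcases hi.lt_or_eq with hi | rfl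
      · rw [corrWin_trans q n hi]
        exact .envMove (hstep i hi).1
      · rw [show 2 * i + 2 + 1 = 2 * i + 3 + 2 * 0 by ring, corrWin_winP0]
        exact .envDeadWin hdead
    · rw [corrWin_trans q n hi, show 2 * i + 3 + 1 = 2 * (i + 1) + 2 by ring,
        corrWin_state q n hi]
      exact .sysMove (hstep i hi).1 (hstep i hi).2
    · rw [corrWin_winP0, show 2 * n + 3 + 2 * m + 1 = 2 * n + 4 + 2 * m by ring, corrWin_winP1]
      exact .winCyc1
    · rw [corrWin_winP1, show 2 * n + 4 + 2 * m + 1 = 2 * n + 3 + 2 * (m + 1) by ring,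
        corrWin_winP0]
      exact .winCyc2

variable (c : ℕ)

lemma REL_succ (p : ℕ → RV Se Ss) (k : ℕ) :
    REL G c p (k + 1) = REL G c p k + wR G (p k) (p (k + 1)) := by
  simp only [REL, Finset.sum_range_succ, add_assoc]

lemma REL_corrWin_one : REL G c (corrWin q n) 1 = c := by
  simp [REL, corrWin_zero, wR]

lemma REL_corrWin_trans_eq_state {i : ℕ} (hi : i ≤ n) :
    REL G c (corrWin q n) (2 * i + 3) = REL G c (corrWin q n) (2 * i + 2) := by
  rw [REL_succ, corrWin_state q n hi]
  rcases hi.lt_or_eq with hi | rfl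
  · rw [corrWin_trans q n hi]
    simp [wR]
  · rw [show 2 * i + 2 + 1 = 2 * i + 3 + 2 * 0 by ring, corrWin_winP0]
    simp [wR]

lemma REL_corrWin_state {i : ℕ} (hi : i ≤ n) :
    REL G c (corrWin q n) (2 * i + 2) = ELsym G c q i := by
  induction i with
  | zero =>
    rw [show 2 * 0 + 2 = 1 + 1 from rfl, REL_succ, REL_corrWin_one, corrWin_one,
      show 1 + 1 = 2 * 0 + 2 from rfl, corrWin_state q n hi]
    simp [wR, ELsym]
  | succ i ih =>
    have hlt : i < n := hi
    rw [show 2 * (i + 1) + 2 = 2 * i + 3 + 1 by ring, REL_succ,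
      REL_corrWin_trans_eq_state q n G c hlt.le, ih hlt.le, corrWin_trans q n hlt,
      show 2 * i + 3 + 1 = 2 * (i + 1) + 2 by ring, corrWin_state q n hi]
    simp only [wR, ELsym, Finset.sum_range_succ, add_assoc]

lemma REL_corrWin_win_le (m : ℕ) :
    ELsym G c q n ≤ REL G c (corrWin q n) (2 * n + 3 + m) := by
  induction m with
  | zero =>
    rw [add_zero, REL_corrWin_trans_eq_state q n G c le_rfl, REL_corrWin_state q n G c le_rfl]
  | succ m ih =>
    rw [← add_assoc, REL_succ]
    refine ih.trans (le_add_of_nonneg_right ?_)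
    rcases Nat.even_or_odd' m with ⟨l, rfl | rfl⟩
    · rw [corrWin_winP0, show 2 * n + 3 + 2 * l + 1 = 2 * n + 4 + 2 * l by ring, corrWin_winP1]
      simp [wR]
    · rw [show 2 * n + 3 + (2 * l + 1) = 2 * n + 4 + 2 * l by ring, corrWin_winP1,
        show 2 * n + 4 + 2 * l + 1 = 2 * n + 3 + 2 * (l + 1) by ring, corrWin_winP0]
      simp [wR]

lemma REL_corrWin_nonneg_iff :
    (∀ k, 1 ≤ k → 0 ≤ REL G c (corrWin q n) k) ↔
      ∀ k, 1 ≤ k → k ≤ n → 0 ≤ ELsym G c q k := by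
  constructor
  · intro h k _ hk
    rw [← REL_corrWin_state q n G c hk]
    exact h _ (by omega)
  · intro h k hk
    have hEL : ∀ i ≤ n, 0 ≤ ELsym G c q i := by
      intro i hi
      rcases Nat.eq_zero_or_pos i with rfl | hpos
      · simp [ELsym]
      · exact h i hpos hi
    rcases corrWin_index_cases n k with
      rfl | rfl | ⟨i, hi, rfl⟩ | ⟨i, hi, rfl⟩ | ⟨m, rfl⟩ | ⟨m, rfl⟩
    · omega
    · simp [REL_corrWin_one]
    · rw [REL_corrWin_state q n G c hi]
      exact hEL i hi
    · rw [REL_corrWin_trans_eq_state q n G c hi.le, REL_corrWin_state q n G c hi.le]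
      exact hEL i hi.le
    · exact (hEL n le_rfl).trans (REL_corrWin_win_le q n G c _)
    · rw [show 2 * n + 4 + 2 * m = 2 * n + 3 + (2 * m + 1) by ring]
      exact (hEL n le_rfl).trans (REL_corrWin_win_le q n G c _)

end CorrWin

/-- Theorem 2: given an initial credit `c`, for all `e ∈ ℕ`, `n ∈ ℕ`, and
`1 ≤ j ≤ n`, there is a finite winning reactive EG play `p^sym = s₀…s_n` on `G^sym` ending
with a deadlock for the environment and `EL(p^sym, j) = e` iff there is an EG play
`p = v_∅ v_{sᵉ₀} v_{s₀} … v_{s_n} (v₀^win v₁^win)^ω` on `Γ^R` with `EL(p, 2+2j) = e` and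
`EL(p, k) ≥ 0` for all `k ≥ 1`. -/
theorem stmt8 (G : SymGG Se Ss) (c : ℕ) (e : ℕ) (n j : ℕ) (h1 : 1 ≤ j) (h2 : j ≤ n) :
    (∃ q : ℕ → Se × Ss, IsFiniteReactivePlay G q n ∧ G.envDeadlock (q n) ∧
        ELsym G c q j = (e : ℤ) ∧ ∀ k, 1 ≤ k → k ≤ n → 0 ≤ ELsym G c q k) ↔
      (∃ q : ℕ → Se × Ss, IsRPlay G (corrWin q n) ∧
        REL G c (corrWin q n) (2 + 2 * j) = (e : ℤ) ∧
        ∀ k, 1 ≤ k → 0 ≤ REL G c (corrWin q n) k) := by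
  refine exists_congr fun q => ?_
  rw [isRPlay_corrWin_iff, REL_corrWin_nonneg_iff, add_comm 2 (2 * j),
    REL_corrWin_state q n G c h2, and_assoc]
end

section
/- Given an initial credit c ∈ ℕ: there exists a finite losing reactive EG play p^sym = s^e on G^sym consisting of a single initial state s^e ∈ θ^e that is an initial deadlock for the system if and only if there exists an EG play p = v_∅ v_{s^e} (v^loss₁ v^loss₀)^ω on Γ^R and there exists k ≥ 1 with EL(p,k) < 0. -/
universe u v

variable {Se : Type u} {Ss : Type v}

/-- The play `v_∅ v_{sᵉ} (v₁^loss v₀^loss)^ω` on `Γ^R`. -/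
def pLoss (Se : Type u) (Ss : Type v) (se : Se) : ℕ → RV Se Ss := fun k =>
  if k = 0 then .init
  else if k = 1 then .initEnv se
  else if k % 2 = 0 then .lossP1 else .lossP0

theorem pLoss_two_mul_add_two (se : Se) (m : ℕ) : pLoss Se Ss se (2 * m + 2) = .lossP1 := by
  simp [pLoss]

theorem pLoss_two_mul_add_three (se : Se) (m : ℕ) : pLoss Se Ss se (2 * m + 3) = .lossP0 := by
  simp [pLoss]

theorem isRPlay_pLoss {G : SymGG Se Ss} {se : Se} (hE : G.thetaE se)
    (hd : G.initSysDeadlock se) : IsRPlay G (pLoss Se Ss se) := by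
  intro i
  rcases i with _ | _ | i
  · exact .toInitEnv hE
  · exact .initSysDead hE hd
  · obtain ⟨m, rfl | rfl⟩ := i.even_or_odd'
    · rw [pLoss_two_mul_add_two, pLoss_two_mul_add_three]
      exact .lossCyc2
    · rw [pLoss_two_mul_add_three, show 2 * m + 1 + 1 + 1 + 1 = 2 * (m + 1) + 2 by ring,
        pLoss_two_mul_add_two]
      exact .lossCyc1

/-- Every second step of `pLoss`, from the second step on, costs one unit of energy. -/
theorem REL_pLoss_two_mul (G : SymGG Se Ss) (c : ℕ) (se : Se) (m : ℕ) :
    REL G c (pLoss Se Ss se) (2 * m) = c - m := by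
  induction m with
  | zero => simp [REL]
  | succ m ih =>
    have h : wR G (pLoss Se Ss se (2 * m)) (pLoss Se Ss se (2 * m + 1)) +
        wR G (pLoss Se Ss se (2 * m + 1)) (pLoss Se Ss se (2 * m + 2)) = -1 := by
      rcases m with _ | m
      · simp [pLoss, wR]
      · rw [show 2 * (m + 1) = 2 * m + 2 by ring, pLoss_two_mul_add_two,
          pLoss_two_mul_add_three, show 2 * m + 2 + 2 = 2 * (m + 1) + 2 by ring,
          pLoss_two_mul_add_two]
        simp [wR]
    rw [show 2 * (m + 1) = 2 * m + 1 + 1 by ring]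
    unfold REL at ih ⊢
    rw [Finset.sum_range_succ, Finset.sum_range_succ]
    push_cast
    linarith

/-- Theorem 3: given an initial credit `c`, there is a finite losing
reactive EG play `p^sym = sᵉ` on `G^sym` consisting of a single initial state `sᵉ ∈ θᵉ` that
is an initial deadlock for the system iff there is an EG play
`p = v_∅ v_{sᵉ} (v₁^loss v₀^loss)^ω` on `Γ^R` and some `k ≥ 1` with `EL(p, k) < 0`. -/
theorem stmt9 (G : SymGG Se Ss) (c : ℕ) (se : Se) :
    (G.thetaE se ∧ G.initSysDeadlock se) ↔
      (IsRPlay G (pLoss Se Ss se) ∧ ∃ k, 1 ≤ k ∧ REL G c (pLoss Se Ss se) k < 0) := by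
  constructor
  · rintro ⟨hE, hd⟩
    refine ⟨isRPlay_pLoss hE hd, 2 * (c + 1), by omega, ?_⟩
    rw [REL_pLoss_two_mul]
    push_cast
    linarith
  · rintro ⟨hp, -⟩
    have h₀ : REdge G .init (.initEnv se) := hp 0
    have h₁ : REdge G (.initEnv se) .lossP1 := hp 1
    cases h₀ with
    | toInitEnv hE =>
      cases h₁ with
      | initSysDead _ hd => exact ⟨hE, hd⟩
end
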